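/- arXiv:2108.07890 — 2 statements merged into one kernel-verified Lean document; each statement's English description precedes it below -/
import Mathlib

section
/- For every integer n ≥ 3, n ≡ 2 (mod 3) if and only if ε_Δ(OP_n) = 2; in particular, for n ≡ 2 (mod 3) there exists a maximal outerplanar graph G of order n and a multiset of two edges of G whose duplication yields a triangle decomposable multigraph, and 2 is the minimum possible over all maximal outerplanar graphs of order n. -/
/-- A triangle on three distinct vertices, as a multiset of edges. -/
def IsTriangle {V : Type*} (t : Multiset (Sym2 V)) : Prop :=
  ∃ a b c : V, a ≠ b ∧ b ≠ c ∧ a ≠ c ∧ t = {s(a, b), s(b, c), s(a, c)}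

/-- A multigraph (multiset of edges) is triangle decomposable if it is a sum of triangles. -/
def TriDecomp {V : Type*} (E : Multiset (Sym2 V)) : Prop :=
  ∃ T : Multiset (Multiset (Sym2 V)), (∀ t ∈ T, IsTriangle t) ∧ T.sum = E

/-- The edge multiset of a simple graph on a finite vertex type. -/
noncomputable def edgeMS {V : Type*} [Fintype V] (G : SimpleGraph V) : Multiset (Sym2 V) :=
  G.edgeSet.toFinite.toFinset.val

/-- `ε_Δ(G)`: the least number of duplicated edges of `G` (a multiset of edges of `G`,
repetitions allowed) whose addition makes the edge multiset triangle decomposable. -/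
noncomputable def epsDelta {V : Type*} [Fintype V] (G : SimpleGraph V) : ℕ :=
  sInf {k | ∃ D : Multiset (Sym2 V), D.card = k ∧ (∀ e ∈ D, e ∈ G.edgeSet) ∧
    TriDecomp (edgeMS G + D)}

/-- The edge set of the simple-clique 2-tree construction on `Fin n`: start with the
triangle on `0,1,2`, and each vertex `k ≥ 3` is attached to the two vertices `a k, b k`. -/
def mopEdges (n : ℕ) (hn : 3 ≤ n) (a b : Fin n → Fin n) : Set (Sym2 (Fin n)) :=
  {e | e = s(⟨0, by omega⟩, ⟨1, by omega⟩) ∨ e = s(⟨1, by omega⟩, ⟨2, by omega⟩) ∨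
       e = s(⟨0, by omega⟩, ⟨2, by omega⟩) ∨
       ∃ k : Fin n, 3 ≤ (k : ℕ) ∧ (e = s(k, a k) ∨ e = s(k, b k))}

/-- `G` is a maximal outerplanar graph (equivalently, a simple-clique 2-tree):
it is built from a triangle by repeatedly adding a new vertex adjacent to exactly the two
endpoints of an existing edge, each edge being used as an attachment edge at most once. -/
def IsMOP {n : ℕ} (G : SimpleGraph (Fin n)) : Prop :=
  ∃ (hn : 3 ≤ n) (a b : Fin n → Fin n),
    (∀ k : Fin n, 3 ≤ (k : ℕ) → (a k : ℕ) < k ∧ (b k : ℕ) < k ∧ a k ≠ b k) ∧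
    (∀ k : Fin n, 3 ≤ (k : ℕ) → s(a k, b k) ∈ mopEdges n hn a b) ∧
    (∀ k l : Fin n, 3 ≤ (k : ℕ) → 3 ≤ (l : ℕ) → k ≠ l → s(a k, b k) ≠ s(a l, b l)) ∧
    G = SimpleGraph.fromEdgeSet (mopEdges n hn a b)

/-- `ε_Δ(OP_n) = min { ε_Δ(G) : G a maximal outerplanar graph of order n }`. -/
noncomputable def epsOP (n : ℕ) : ℕ :=
  sInf {m | ∃ G : SimpleGraph (Fin n), IsMOP G ∧ epsDelta G = m}

theorem IsTriangle.triDecomp {V : Type*} {t : Multiset (Sym2 V)} (ht : IsTriangle t) :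
    TriDecomp t :=
  ⟨{t}, by simpa using ht, by simp⟩

theorem TriDecomp.add {V : Type*} {E F : Multiset (Sym2 V)} (hE : TriDecomp E)
    (hF : TriDecomp F) : TriDecomp (E + F) := by
  obtain ⟨S, hS, rfl⟩ := hE
  obtain ⟨T, hT, rfl⟩ := hF
  refine ⟨S + T, fun t ht => ?_, by simp⟩
  rcases Multiset.mem_add.1 ht with h | h
  exacts [hS t h, hT t h]

theorem TriDecomp.three_dvd_card {V : Type*} {E : Multiset (Sym2 V)} (hE : TriDecomp E) :
    3 ∣ E.card := by
  obtain ⟨T, hT, rfl⟩ := hE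
  rw [← Multiset.join, Multiset.card_join]
  refine Multiset.dvd_sum fun x hx => ?_
  obtain ⟨t, ht, rfl⟩ := Multiset.mem_map.1 hx
  obtain ⟨a, b, c, -, -, -, rfl⟩ := hT t ht
  simp

theorem mem_edgeMS {V : Type*} [Fintype V] {G : SimpleGraph V} {e : Sym2 V} :
    e ∈ edgeMS G ↔ e ∈ G.edgeSet := by
  simp [edgeMS]

theorem nodup_edgeMS {V : Type*} [Fintype V] (G : SimpleGraph V) : (edgeMS G).Nodup :=
  Finset.nodup _

/-- If every edge lies on a triangle, some multiset of duplicated edges makes the graph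
triangle decomposable. -/
theorem exists_triDecomp_of_forall_mem_triangle {V : Type*} [Fintype V] {G : SimpleGraph V}
    (h : ∀ e ∈ G.edgeSet, ∃ t, IsTriangle t ∧ e ∈ t ∧ ∀ x ∈ t, x ∈ G.edgeSet) :
    ∃ D : Multiset (Sym2 V), (∀ e ∈ D, e ∈ G.edgeSet) ∧ TriDecomp (edgeMS G + D) := by
  classical
  choose! t ht het hsub using h
  have hle : edgeMS G ≤ ((edgeMS G).map t).sum := by
    refine (Multiset.le_iff_subset (nodup_edgeMS G)).2 fun e he => ?_
    exact Multiset.mem_of_le (Multiset.single_le_sum (fun _ _ => zero_le) _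
      (Multiset.mem_map_of_mem t he)) (het e (mem_edgeMS.1 he))
  obtain ⟨D, hD⟩ := Multiset.le_iff_exists_add.1 hle
  refine ⟨D, fun e he => ?_, (edgeMS G).map t, ?_, hD⟩
  · have : e ∈ (edgeMS G).bind t := by
      rw [Multiset.bind, Multiset.join, hD]
      exact Multiset.mem_add.2 (Or.inr he)
    obtain ⟨f, hf, hef⟩ := Multiset.mem_bind.1 this
    exact hsub f (mem_edgeMS.1 hf) e hef
  · intro s hs
    obtain ⟨f, hf, rfl⟩ := Multiset.mem_map.1 hs
    exact ht f (mem_edgeMS.1 hf)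

section Construction

variable {n : ℕ} {hn : 3 ≤ n} {a b : Fin n → Fin n}

theorem not_isDiag_of_mem_mopEdges
    (hab : ∀ k : Fin n, 3 ≤ (k : ℕ) → (a k : ℕ) < k ∧ (b k : ℕ) < k ∧ a k ≠ b k)
    {e : Sym2 (Fin n)} (he : e ∈ mopEdges n hn a b) : ¬ e.IsDiag := by
  rcases he with rfl | rfl | rfl | ⟨k, hk, rfl | rfl⟩
  · simp
  · simp
  · simp
  · have := (hab k hk).1
    simp only [Sym2.mk_isDiag_iff, Fin.ext_iff]
    omega
  · have := (hab k hk).2.1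
    simp only [Sym2.mk_isDiag_iff, Fin.ext_iff]
    omega

theorem edgeSet_fromEdgeSet_mopEdges
    (hab : ∀ k : Fin n, 3 ≤ (k : ℕ) → (a k : ℕ) < k ∧ (b k : ℕ) < k ∧ a k ≠ b k) :
    (SimpleGraph.fromEdgeSet (mopEdges n hn a b)).edgeSet = mopEdges n hn a b := by
  rw [SimpleGraph.edgeSet_fromEdgeSet, sdiff_eq_left, Set.disjoint_left]
  exact fun e he => not_isDiag_of_mem_mopEdges hab he

/-- The edge multiset of a simple-clique 2-tree, listed in construction order. -/
theorem edgeMS_fromEdgeSet_mopEdges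
    (hab : ∀ k : Fin n, 3 ≤ (k : ℕ) → (a k : ℕ) < k ∧ (b k : ℕ) < k ∧ a k ≠ b k) :
    edgeMS (SimpleGraph.fromEdgeSet (mopEdges n hn a b)) =
      {s(⟨0, by omega⟩, ⟨1, by omega⟩), s(⟨1, by omega⟩, ⟨2, by omega⟩),
        s(⟨0, by omega⟩, ⟨2, by omega⟩)} +
      ∑ k ∈ Finset.univ.filter fun k : Fin n => 3 ≤ (k : ℕ), {s(k, a k), s(k, b k)} := by
  refine ((nodup_edgeMS _).ext ?_).2 fun e => ?_
  · change Multiset.Nodup (_ + Multiset.bind _ _)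
    rw [Multiset.nodup_add, Multiset.nodup_bind]
    refine ⟨by simp [Fin.ext_iff], ⟨fun k hk => ?_, ?_⟩, ?_⟩
    · have := hab k (by simpa using hk)
      simp only [Multiset.insert_eq_cons, Multiset.nodup_cons, Multiset.mem_singleton,
        Multiset.nodup_singleton, and_true, Sym2.eq_iff, Fin.ext_iff] at this ⊢
      omega
    · refine Multiset.Nodup.pairwise (fun k hk l hl hkl => ?_) (Finset.nodup _)
      have h1 := hab k (by simpa using hk)
      have h2 := hab l (by simpa using hl)
      simp only [Function.onFun, Multiset.insert_eq_cons, Multiset.disjoint_cons_left,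
        Multiset.singleton_disjoint, Multiset.mem_cons, Multiset.mem_singleton,
        Sym2.eq_iff, Fin.ext_iff] at h1 h2 hkl ⊢
      omega
    · rw [Multiset.disjoint_right]
      intro e he
      obtain ⟨k, hk, he⟩ := Multiset.mem_bind.1 he
      have hk3 : 3 ≤ (k : ℕ) := by simpa using hk
      have h1 := hab k hk3
      simp only [Multiset.insert_eq_cons, Multiset.mem_cons, Multiset.mem_singleton] at he ⊢
      rcases he with rfl | rfl <;> simp only [Sym2.eq_iff, Fin.ext_iff] <;> omega
  · rw [mem_edgeMS, edgeSet_fromEdgeSet_mopEdges hab]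
    simp [mopEdges, Multiset.mem_sum]

end Construction

theorem IsMOP.exists_triDecomp {n : ℕ} {G : SimpleGraph (Fin n)} (hG : IsMOP G) :
    ∃ D : Multiset (Sym2 (Fin n)), (∀ e ∈ D, e ∈ G.edgeSet) ∧ TriDecomp (edgeMS G + D) := by
  obtain ⟨hn, a, b, hab, hmem, -, rfl⟩ := hG
  apply exists_triDecomp_of_forall_mem_triangle
  rw [edgeSet_fromEdgeSet_mopEdges hab]
  have base : ∀ e : Sym2 (Fin n), e = s(⟨0, by omega⟩, ⟨1, by omega⟩) ∨
      e = s(⟨1, by omega⟩, ⟨2, by omega⟩) ∨ e = s(⟨0, by omega⟩, ⟨2, by omega⟩) →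
      ∃ t, IsTriangle t ∧ e ∈ t ∧ ∀ x ∈ t, x ∈ mopEdges n hn a b := fun e he =>
    ⟨_, ⟨⟨0, by omega⟩, ⟨1, by omega⟩, ⟨2, by omega⟩, by simp, by simp, by simp, rfl⟩,
      by simpa using he, by simp [mopEdges]⟩
  have step : ∀ k : Fin n, 3 ≤ (k : ℕ) → ∀ e : Sym2 (Fin n), e = s(k, a k) ∨ e = s(k, b k) →
      ∃ t, IsTriangle t ∧ e ∈ t ∧ ∀ x ∈ t, x ∈ mopEdges n hn a b := by
    intro k hk e he
    have h := hab k hk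
    refine ⟨_, ⟨k, a k, b k, ?_, h.2.2, ?_, rfl⟩, ?_, ?_⟩
    · rw [ne_eq, Fin.ext_iff]; omega
    · rw [ne_eq, Fin.ext_iff]; omega
    · simpa using he.imp_right Or.inr
    · simp only [Multiset.insert_eq_cons, Multiset.mem_cons, Multiset.mem_singleton]
      rintro x (rfl | rfl | rfl)
      · exact Or.inr (Or.inr (Or.inr ⟨k, hk, Or.inl rfl⟩))
      · exact hmem k hk
      · exact Or.inr (Or.inr (Or.inr ⟨k, hk, Or.inr rfl⟩))
  rintro e (he | he | he | ⟨k, hk, he⟩)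
  exacts [base e (Or.inl he), base e (Or.inr (Or.inl he)), base e (Or.inr (Or.inr he)),
    step k hk e he]

theorem IsMOP.card_edgeMS {n : ℕ} {G : SimpleGraph (Fin n)} (hG : IsMOP G) :
    (edgeMS G).card + 3 = 2 * n := by
  obtain ⟨hn, a, b, hab, -, -, rfl⟩ := hG
  rw [edgeMS_fromEdgeSet_mopEdges hab]
  have h : (Finset.univ.filter fun k : Fin n => 3 ≤ (k : ℕ)).card = n - 3 := by
    rw [← Finset.card_map Fin.valEmbedding,
      show (Finset.univ.filter fun k : Fin n => 3 ≤ (k : ℕ)).map Fin.valEmbedding =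
        Finset.Ico 3 n by
          ext k
          simp only [Finset.mem_map, Finset.mem_filter, Finset.mem_univ, true_and,
            Fin.valEmbedding_apply, Finset.mem_Ico]
          exact ⟨by rintro ⟨k, hk, rfl⟩; exact ⟨hk, k.2⟩, fun hk => ⟨⟨k, hk.2⟩, hk.1, rfl⟩⟩,
      Nat.card_Ico]
  simp only [Multiset.card_add, Multiset.card_sum, Multiset.insert_eq_cons, Multiset.card_cons,
    Multiset.card_singleton, Finset.sum_const, h, smul_eq_mul]
  omega

theorem IsMOP.card_mod_three {n : ℕ} {G : SimpleGraph (Fin n)} (hG : IsMOP G)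
    {D : Multiset (Sym2 (Fin n))} (hD : TriDecomp (edgeMS G + D)) : D.card % 3 = n % 3 := by
  have h1 := hD.three_dvd_card
  have h2 := hG.card_edgeMS
  rw [Multiset.card_add] at h1
  omega

theorem IsMOP.epsDelta_mod_three {n : ℕ} {G : SimpleGraph (Fin n)} (hG : IsMOP G) :
    epsDelta G % 3 = n % 3 := by
  obtain ⟨D, hDG, hD⟩ := hG.exists_triDecomp
  obtain ⟨E, hcard, -, hE⟩ := Nat.sInf_mem (s := {k | ∃ D : Multiset (Sym2 (Fin n)),
    D.card = k ∧ (∀ e ∈ D, e ∈ G.edgeSet) ∧ TriDecomp (edgeMS G + D)}) ⟨_, D, rfl, hDG, hD⟩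
  rw [epsDelta, ← hcard]
  exact hG.card_mod_three hE

/-- First attachment vertex of the extremal example: a strip of three triangles on `0, …, 4`,
followed by blocks of three vertices `x, x + 1, x + 2` with `x ≡ 2 (mod 3)`, where `x` is
attached to `{x - 3, x - 1}`, `x + 1` to `{x - 3, x}` and `x + 2` to `{x - 1, x}`. -/
def attachFst (k : ℕ) : ℕ :=
  if k < 5 then k - 2 else if k % 3 = 0 then k - 4 else k - 3

/-- Second attachment vertex of the extremal example; see `attachFst`. -/
def attachSnd (k : ℕ) : ℕ :=
  if k < 5 then k - 1 else if k % 3 = 1 then k - 2 else k - 1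

theorem attachFst_lt_attachSnd {k : ℕ} (hk : 3 ≤ k) : attachFst k < attachSnd k := by
  unfold attachFst attachSnd; split_ifs <;> omega

theorem attachSnd_lt {k : ℕ} (hk : 3 ≤ k) : attachSnd k < k := by
  unfold attachSnd; split_ifs <;> omega

theorem attachFst_lt {k : ℕ} (hk : 3 ≤ k) : attachFst k < k :=
  (attachFst_lt_attachSnd hk).trans (attachSnd_lt hk)

theorem attach_injective {k l : ℕ} (hk : 3 ≤ k) (hl : 3 ≤ l)
    (h₁ : attachFst k = attachFst l) (h₂ : attachSnd k = attachSnd l) : k = l := by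
  unfold attachFst at h₁; unfold attachSnd at h₂; split_ifs at h₁ h₂ <;> omega

theorem attach_edge {k : ℕ} (hk : 3 ≤ k) : (attachFst k = 1 ∧ attachSnd k = 2) ∨
    (3 ≤ attachSnd k ∧ (attachFst k = attachFst (attachSnd k) ∨
      attachFst k = attachSnd (attachSnd k))) := by
  unfold attachFst attachSnd; split_ifs <;> omega

theorem triDecomp_attach {V : Type*} {n : ℕ} (c : ℕ → V) (hc : Set.InjOn c (Set.Iio n)) (m : ℕ)
    (hm : 3 * m + 5 ≤ n) :
    TriDecomp ({s(c 0, c 1), s(c 1, c 2), s(c 0, c 2)} +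
      ∑ k ∈ Finset.Ico 3 (3 * m + 5),
        {s(c k, c (attachFst k)), s(c k, c (attachSnd k))} +
      {s(c 1, c 2), s(c 2, c 3)}) := by
  have tri : ∀ i j k, i < j → j < k → k < n →
      TriDecomp ({s(c i, c j), s(c j, c k), s(c i, c k)} : Multiset (Sym2 V)) := by
    intro i j k hij hjk hk
    have hne : ∀ p q, p < q → q < n → c p ≠ c q := fun p q hpq hq h =>
      hpq.ne (hc (Set.mem_Iio.2 (hpq.trans hq)) (Set.mem_Iio.2 hq) h)
    exact IsTriangle.triDecomp ⟨c i, c j, c k, hne _ _ hij (by omega), hne _ _ hjk hk,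
      hne _ _ (by omega) hk, rfl⟩
  induction m with
  | zero =>
    convert ((tri 0 1 2 (by omega) (by omega) (by omega)).add
      (tri 1 2 3 (by omega) (by omega) (by omega))).add
      (tri 2 3 4 (by omega) (by omega) (by omega)) using 1
    rw [show Finset.Ico 3 (3 * 0 + 5) = {3, 4} by decide, Finset.sum_pair (by decide)]
    have e1 : attachFst 3 = 1 := rfl
    have e2 : attachSnd 3 = 2 := rfl
    have e3 : attachFst 4 = 2 := rfl
    have e4 : attachSnd 4 = 3 := rfl
    rw [e1, e2, e3, e4]
    simp only [Multiset.insert_eq_cons, ← Multiset.singleton_add]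
    rw [Sym2.eq_swap (a := c 3) (b := c 1), Sym2.eq_swap (a := c 3) (b := c 2),
      Sym2.eq_swap (a := c 4) (b := c 2), Sym2.eq_swap (a := c 4) (b := c 3)]
    abel
  | succ m ih =>
    convert ((ih (by omega)).add
      (tri (3 * m + 2) (3 * m + 5) (3 * m + 6) (by omega) (by omega) (by omega))).add
      (tri (3 * m + 4) (3 * m + 5) (3 * m + 7) (by omega) (by omega) (by omega)) using 1
    rw [show 3 * (m + 1) + 5 = 3 * m + 5 + 1 + 1 + 1 by ring,
      Finset.sum_Ico_succ_top (by omega), Finset.sum_Ico_succ_top (by omega),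
      Finset.sum_Ico_succ_top (by omega)]
    have e1 : attachFst (3 * m + 5) = 3 * m + 2 := by unfold attachFst; split_ifs <;> omega
    have e2 : attachSnd (3 * m + 5) = 3 * m + 4 := by unfold attachSnd; split_ifs <;> omega
    have e3 : attachFst (3 * m + 5 + 1) = 3 * m + 2 := by unfold attachFst; split_ifs <;> omega
    have e4 : attachSnd (3 * m + 5 + 1) = 3 * m + 5 := by unfold attachSnd; split_ifs <;> omega
    have e5 : attachFst (3 * m + 5 + 1 + 1) = 3 * m + 4 := by
      unfold attachFst; split_ifs <;> omega
    have e6 : attachSnd (3 * m + 5 + 1 + 1) = 3 * m + 5 := by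
      unfold attachSnd; split_ifs <;> omega
    rw [e1, e2, e3, e4, e5, e6]
    simp only [Multiset.insert_eq_cons, ← Multiset.singleton_add, add_assoc]
    rw [Sym2.eq_swap (a := c (3 * m + 5)) (b := c (3 * m + 2)),
      Sym2.eq_swap (a := c (3 * m + 5)) (b := c (3 * m + 4)),
      Sym2.eq_swap (a := c (3 * m + 6)) (b := c (3 * m + 2)),
      Sym2.eq_swap (a := c (3 * m + 6)) (b := c (3 * m + 5)),
      Sym2.eq_swap (a := c (3 * m + 7)) (b := c (3 * m + 4)),
      Sym2.eq_swap (a := c (3 * m + 7)) (b := c (3 * m + 5))]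
    abel

theorem exists_isMOP_triDecomp {n : ℕ} (hn : 3 ≤ n) (hmod : n % 3 = 2) :
    ∃ G : SimpleGraph (Fin n), IsMOP G ∧
      ∃ D : Multiset (Sym2 (Fin n)), D.card = 2 ∧ (∀ e ∈ D, e ∈ G.edgeSet) ∧
        TriDecomp (edgeMS G + D) := by
  have : NeZero n := ⟨by omega⟩
  have hval : ∀ i < n, ((Fin.ofNat n i : Fin n) : ℕ) = i := fun i hi => Nat.mod_eq_of_lt hi
  let a : Fin n → Fin n := fun k => Fin.ofNat n (attachFst k)
  let b : Fin n → Fin n := fun k => Fin.ofNat n (attachSnd k)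
  have ha : ∀ k : Fin n, 3 ≤ (k : ℕ) → (a k : ℕ) = attachFst k := fun k hk =>
    hval _ ((attachFst_lt hk).trans k.2)
  have hb : ∀ k : Fin n, 3 ≤ (k : ℕ) → (b k : ℕ) = attachSnd k := fun k hk =>
    hval _ ((attachSnd_lt hk).trans k.2)
  have hab : ∀ k : Fin n, 3 ≤ (k : ℕ) → (a k : ℕ) < k ∧ (b k : ℕ) < k ∧ a k ≠ b k := by
    intro k hk
    rw [ne_eq, Fin.ext_iff, ha k hk, hb k hk]
    exact ⟨attachFst_lt hk, attachSnd_lt hk, (attachFst_lt_attachSnd hk).ne⟩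
  refine ⟨SimpleGraph.fromEdgeSet (mopEdges n hn a b), ⟨hn, a, b, hab, ?_, ?_, rfl⟩,
    {s(Fin.ofNat n 1, Fin.ofNat n 2), s(Fin.ofNat n 2, Fin.ofNat n 3)}, by simp, ?_, ?_⟩
  · intro k hk
    rcases attach_edge hk with ⟨h₁, h₂⟩ | ⟨h, h'⟩
    · refine Or.inr (Or.inl ?_)
      simp only [Sym2.eq_iff, Fin.ext_iff, ha k hk, hb k hk]
      omega
    · have hbk := hb k hk
      refine Or.inr (Or.inr (Or.inr ⟨b k, by omega, ?_⟩))
      simp only [Sym2.eq_iff, Fin.ext_iff, ha k hk, ha (b k) (by omega), hb (b k) (by omega), hbk]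
      tauto
  · intro k l hk hl hkl h
    have h1 := attachFst_lt_attachSnd hk
    have h2 := attachFst_lt_attachSnd hl
    simp only [Sym2.eq_iff, Fin.ext_iff, ha k hk, hb k hk, ha l hl, hb l hl] at h
    exact hkl (Fin.ext (attach_injective hk hl (by omega) (by omega)))
  · rw [edgeSet_fromEdgeSet_mopEdges hab]
    have h3 : ((Fin.ofNat n 3 : Fin n) : ℕ) = 3 := hval 3 (by omega)
    simp only [Multiset.insert_eq_cons, Multiset.mem_cons, Multiset.mem_singleton]
    rintro e (rfl | rfl)
    · refine Or.inr (Or.inl ?_)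
      simp only [Sym2.eq_iff, Fin.ext_iff, hval 1 (by omega), hval 2 (by omega)]
      tauto
    · refine Or.inr (Or.inr (Or.inr ⟨Fin.ofNat n 3, h3.ge, Or.inr ?_⟩))
      rw [Sym2.eq_swap]
      simp only [b, h3]
      rfl
  · obtain ⟨m, rfl⟩ : ∃ m, n = 3 * m + 5 := ⟨(n - 5) / 3, by omega⟩
    have key := triDecomp_attach (n := 3 * m + 5) (Fin.ofNat (3 * m + 5)) (fun i hi j hj h => by
      rw [← hval i hi, ← hval j hj, h]) m le_rfl
    rw [edgeMS_fromEdgeSet_mopEdges hab]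
    convert key using 3
    · have h0 : (⟨0, by omega⟩ : Fin (3 * m + 5)) = Fin.ofNat _ 0 :=
        Fin.ext (hval 0 (by omega)).symm
      have h1 : (⟨1, by omega⟩ : Fin (3 * m + 5)) = Fin.ofNat _ 1 :=
        Fin.ext (hval 1 (by omega)).symm
      have h2 : (⟨2, by omega⟩ : Fin (3 * m + 5)) = Fin.ofNat _ 2 :=
        Fin.ext (hval 2 (by omega)).symm
      rw [h0, h1, h2]
    · refine Finset.sum_bij (fun k _ => (k : ℕ)) (fun k hk => ?_) (fun k _ l _ h => Fin.ext h)
        (fun k hk => ?_) (fun k _ => ?_)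
      · simpa using hk
      · rw [Finset.mem_Ico] at hk
        exact ⟨⟨k, hk.2⟩, by simpa using hk.1, rfl⟩
      · rw [show Fin.ofNat (3 * m + 5) (k : ℕ) = k from Fin.ext (hval k k.2)]

/-- For every `n ≥ 3`, `n ≡ 2 (mod 3)` iff `ε_Δ(OP_n) = 2`; in particular, for
`n ≡ 2 (mod 3)` some maximal outerplanar graph of order `n` becomes triangle decomposable
after duplicating two of its edges, and 2 is the minimum possible over all maximal
outerplanar graphs of order `n`. -/
theorem eps_OP_eq_two_iff (n : ℕ) (hn : 3 ≤ n) :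
    (n % 3 = 2 ↔ epsOP n = 2) ∧
    (n % 3 = 2 →
      (∃ G : SimpleGraph (Fin n), IsMOP G ∧
        ∃ D : Multiset (Sym2 (Fin n)), D.card = 2 ∧ (∀ e ∈ D, e ∈ G.edgeSet) ∧
          TriDecomp (edgeMS G + D)) ∧
      (∀ G : SimpleGraph (Fin n), IsMOP G → 2 ≤ epsDelta G)) := by
  have lower : n % 3 = 2 → ∀ G : SimpleGraph (Fin n), IsMOP G → 2 ≤ epsDelta G := by
    intro h G hG
    have := hG.epsDelta_mod_three
    omega
  refine ⟨⟨fun h => ?_, fun h => ?_⟩, fun h => ⟨exists_isMOP_triDecomp hn h, lower h⟩⟩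
  · obtain ⟨G, hG, hD⟩ := exists_isMOP_triDecomp hn h
    have hG2 : epsDelta G = 2 := le_antisymm (Nat.sInf_le hD) (lower h G hG)
    refine le_antisymm (Nat.sInf_le ⟨G, hG, hG2⟩) (le_csInf ⟨2, G, hG, hG2⟩ ?_)
    rintro _ ⟨G', hG', rfl⟩
    exact lower h G' hG'
  · obtain ⟨G, hG, hG2⟩ := Nat.sInf_mem (Nat.nonempty_of_pos_sInf
      (show 0 < epsOP n by omega))
    have h1 := hG.epsDelta_mod_three
    change epsDelta G = epsOP n at hG2
    omega
end

section
/- For all integers m ≥ 3 and k ≥ 1, there exists a simple graph G on k·m vertices with ε_Δ(G) equal to the least nonnegative residue of m modulo 3, where G is obtained from some maximal outerplanar graph H of order m with Hamiltonian cycle u_0, …, u_{m−1} by iteratively adding k − 1 outer layers: each new layer consists of m new vertices v_0, …, v_{m−1} joined to the current outermost layer u_0, …, u_{m−1} by the edges v_i v_{(i+1) mod m}, v_i u_i, and v_i u_{(i+1) mod m} for 0 ≤ i < m. -/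
/-- The cyclic successor on `Fin m`. -/
def nextFin {m : ℕ} (hm : 0 < m) (i : Fin m) : Fin m :=
  ⟨((i : ℕ) + 1) % m, Nat.mod_lt _ hm⟩

/-- The graph obtained from `G` by adding an outer layer of `m` new vertices
`v_0, …, v_{m-1}` (the `Sum.inr` vertices), with the edges `v_i v_{i+1 mod m}`,
`v_i u_i` and `v_i u_{i+1 mod m}` for `0 ≤ i < m`. -/
def layerExt {V : Type*} (m : ℕ) (hm : 0 < m) (G : SimpleGraph V) (u : Fin m → V) :
    SimpleGraph (V ⊕ Fin m) :=
  SimpleGraph.fromEdgeSet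
    ({e | ∃ x y : V, G.Adj x y ∧ e = s(Sum.inl x, Sum.inl y)} ∪
     {e | ∃ i : Fin m, e = s(Sum.inr i, Sum.inr (nextFin hm i)) ∨
          e = s(Sum.inr i, Sum.inl (u i)) ∨
          e = s(Sum.inr i, Sum.inl (u (nextFin hm i)))})

/-- The vertex type after adding `k` outer layers of `m` vertices to a base of `m`
vertices. -/
def LayerType (m : ℕ) : ℕ → Type
  | 0 => Fin m
  | k + 1 => LayerType m k ⊕ Fin m

instance LayerType.fintype (m : ℕ) : ∀ k, Fintype (LayerType m k)
  | 0 => inferInstanceAs (Fintype (Fin m))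
  | k + 1 =>
      letI := LayerType.fintype m k
      inferInstanceAs (Fintype (LayerType m k ⊕ Fin m))

/-- Starting from a graph `H` on `Fin m` with designated outermost layer `u`, iteratively
add outer layers of `m` new vertices, each joined to the current outermost layer; the
result after `k` layer additions, together with its (new) outermost layer. -/
def layerData {m : ℕ} (hm : 0 < m) (H : SimpleGraph (Fin m)) (u : Fin m → Fin m) :
    (k : ℕ) → SimpleGraph (LayerType m k) × (Fin m → LayerType m k)
  | 0 => (H, u)
  | k + 1 =>
      let p := layerData hm H u k
      (layerExt m hm p.1 p.2, Sum.inr)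

theorem TriDecomp.zero {V : Type*} : TriDecomp (0 : Multiset (Sym2 V)) :=
  ⟨0, by simp, by simp⟩

theorem TriDecomp.triangle {V : Type*} {a b c : V} (hab : a ≠ b) (hbc : b ≠ c) (hac : a ≠ c) :
    TriDecomp ({s(a, b), s(b, c), s(a, c)} : Multiset (Sym2 V)) :=
  ⟨{{s(a, b), s(b, c), s(a, c)}},
    fun t ht => ⟨a, b, c, hab, hbc, hac, Multiset.mem_singleton.1 ht⟩, by simp⟩

theorem TriDecomp.sum {V ι : Type*} {s : Finset ι} {E : ι → Multiset (Sym2 V)}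
    (h : ∀ i ∈ s, TriDecomp (E i)) : TriDecomp (∑ i ∈ s, E i) :=
  Finset.sum_induction E TriDecomp (fun _ _ => TriDecomp.add) TriDecomp.zero h

theorem TriDecomp.map {V W : Type*} {E : Multiset (Sym2 V)} (hE : TriDecomp E) {f : V → W}
    (hf : Function.Injective f) : TriDecomp (E.map (Sym2.map f)) := by
  obtain ⟨T, hT, rfl⟩ := hE
  induction T using Multiset.induction_on with
  | empty => simpa using TriDecomp.zero
  | cons t T ih =>
    rw [Multiset.sum_cons, Multiset.map_add]
    refine TriDecomp.add ?_ (ih fun s hs => hT s (Multiset.mem_cons_of_mem hs))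
    obtain ⟨a, b, c, hab, hbc, hac, rfl⟩ := hT t (Multiset.mem_cons_self t T)
    simpa using TriDecomp.triangle (hf.ne hab) (hf.ne hbc) (hf.ne hac)

theorem edgeMS_eq {V : Type*} [Fintype V] {G : SimpleGraph V} {M : Multiset (Sym2 V)}
    (hM : M.Nodup) (h : ∀ e, e ∈ G.edgeSet ↔ e ∈ M) : edgeMS G = M :=
  (Multiset.Nodup.ext (Finset.nodup _) hM).2 fun e => mem_edgeMS.trans (h e)

theorem epsDelta_eq_of_card_lt_three {V : Type*} [Fintype V] {G : SimpleGraph V}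
    {D : Multiset (Sym2 V)} (hcard : D.card < 3) (hD : ∀ e ∈ D, e ∈ G.edgeSet)
    (hdec : TriDecomp (edgeMS G + D)) : epsDelta G = D.card := by
  refine le_antisymm (Nat.sInf_le ⟨D, rfl, hD, hdec⟩) (le_csInf ⟨_, D, rfl, hD, hdec⟩ ?_)
  rintro _ ⟨D', rfl, -, hdec'⟩
  have h := hdec.three_dvd_card
  have h' := hdec'.three_dvd_card
  rw [Multiset.card_add] at h h'
  omega

theorem nextFin_val {m : ℕ} (hm : 0 < m) (i : Fin m) :
    (nextFin hm i : ℕ) = if (i : ℕ) + 1 = m then (0 : ℕ) else (i : ℕ) + 1 := by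
  have := i.isLt
  unfold nextFin
  split_ifs with h
  · simp [h]
  · exact Nat.mod_eq_of_lt (by omega)

theorem nextFin_injective {m : ℕ} (hm : 0 < m) : Function.Injective (nextFin hm) := by
  intro i j h
  rw [Fin.ext_iff, nextFin_val, nextFin_val] at h
  ext
  split_ifs at h <;> omega

theorem nextFin_ne {m : ℕ} (hm : 2 ≤ m) (i : Fin m) : nextFin (by omega) i ≠ i := by
  intro h
  rw [Fin.ext_iff, nextFin_val] at h
  split_ifs at h <;> omega

theorem nextFin_nextFin_ne {m : ℕ} (hm : 3 ≤ m) (i : Fin m) :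
    nextFin (by omega) (nextFin (by omega) i) ≠ i := by
  intro h
  rw [Fin.ext_iff, nextFin_val, nextFin_val] at h
  split_ifs at h <;> omega

theorem map_val_eq_sum_singleton {α β : Type*} (s : Finset α) (f : α → β) :
    s.val.map f = ∑ i ∈ s, {f i} := by
  rw [Finset.sum, ← Multiset.sum_map_singleton (s.val.map f), Multiset.map_map]
  rfl

/-- The edges added by an outer layer. -/
def layerEdges {V : Type*} {m : ℕ} (hm : 0 < m) (u : Fin m → V) :
    Multiset (Sym2 (V ⊕ Fin m)) :=
  Finset.univ.val.map (fun i => s(Sum.inr i, Sum.inr (nextFin hm i))) +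
    Finset.univ.val.map (fun i => s(Sum.inr i, Sum.inl (u i))) +
    Finset.univ.val.map (fun i => s(Sum.inr i, Sum.inl (u (nextFin hm i))))

theorem triDecomp_layerEdges {V : Type*} {m : ℕ} (hm : 2 ≤ m) (u : Fin m → V) :
    TriDecomp (layerEdges (by omega) u) := by
  have hm0 : 0 < m := by omega
  have h : TriDecomp (∑ i : Fin m, ({s(Sum.inr i, Sum.inr (nextFin hm0 i)),
      s(Sum.inr (nextFin hm0 i), Sum.inl (u (nextFin hm0 i))),
      s(Sum.inr i, Sum.inl (u (nextFin hm0 i)))} : Multiset (Sym2 (V ⊕ Fin m)))) :=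
    TriDecomp.sum fun i _ => TriDecomp.triangle
      (Sum.inr_injective.ne (nextFin_ne hm i).symm) Sum.inr_ne_inl Sum.inr_ne_inl
  convert h using 1
  have hg := Function.Bijective.sum_comp
    (Finite.injective_iff_bijective.1 (nextFin_injective hm0))
    (fun i => ({s(Sum.inr i, Sum.inl (u i))} : Multiset (Sym2 (V ⊕ Fin m))))
  simp only [Multiset.insert_eq_cons, ← Multiset.singleton_add, Finset.sum_add_distrib, hg]
  simp only [layerEdges, map_val_eq_sum_singleton]
  abel

theorem edgeMS_layerExt {V : Type*} [Fintype V] {m : ℕ} (hm : 3 ≤ m) (G : SimpleGraph V)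
    {u : Fin m → V} (hu : Function.Injective u) :
    edgeMS (layerExt m (by omega) G u) =
      (edgeMS G).map (Sym2.map Sum.inl) + layerEdges (by omega) u := by
  have hne : ∀ i : Fin m, nextFin (by omega) i ≠ i := nextFin_ne (by omega)
  have hu' : ∀ i j, u i = u j ↔ i = j := fun i j => hu.eq_iff
  refine edgeMS_eq ?_ ?_
  · simp only [layerEdges, Multiset.nodup_add]
    refine ⟨(Finset.nodup _).map (Sym2.map.injective Sum.inl_injective),
      ⟨⟨(Finset.nodup _).map ?_, (Finset.nodup _).map ?_, ?_⟩, (Finset.nodup _).map ?_, ?_⟩, ?_⟩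
    · intro i j h
      simp only [Sym2.eq_iff, Sum.inr.injEq] at h
      rcases h with h | ⟨h1, h2⟩
      · exact h.1
      · rw [h1] at h2
        exact absurd h2 (nextFin_nextFin_ne hm j)
    · intro i j h
      simpa [hu'] using h
    · simp [Multiset.disjoint_left]
    · intro i j h
      simp only [Sym2.eq_iff, Sum.inr.injEq, reduceCtorEq, false_and, or_false] at h
      exact h.1
    · simp only [Multiset.disjoint_left, Multiset.mem_add, Multiset.mem_map]
      rintro _ (⟨i, -, rfl⟩ | ⟨i, -, rfl⟩) ⟨j, -, h⟩
      · simp at h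
      · simp only [Sym2.eq_iff, Sum.inr.injEq, Sum.inl.injEq, hu', reduceCtorEq, false_and,
          or_false] at h
        exact hne j (h.2.trans h.1.symm)
    · simp only [Multiset.disjoint_left, Multiset.mem_add, Multiset.mem_map]
      rintro _ ⟨e, -, rfl⟩
      induction e with
      | h x y => simp
  · intro e
    simp only [layerExt, SimpleGraph.edgeSet_fromEdgeSet, Set.mem_sdiff, Set.mem_union,
      Set.mem_ofPred_eq, layerEdges, Multiset.mem_add, Multiset.mem_map, mem_edgeMS,
      Finset.mem_val, Finset.mem_univ, true_and]
    constructor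
    · rintro ⟨⟨x, y, h, rfl⟩ | ⟨i, rfl | rfl | rfl⟩, -⟩
      · exact Or.inl ⟨s(x, y), h, rfl⟩
      · exact Or.inr (Or.inl (Or.inl ⟨i, rfl⟩))
      · exact Or.inr (Or.inl (Or.inr ⟨i, rfl⟩))
      · exact Or.inr (Or.inr ⟨i, rfl⟩)
    · rintro (⟨e, h, rfl⟩ | (⟨i, rfl⟩ | ⟨i, rfl⟩) | ⟨i, rfl⟩)
      · induction e with
        | h x y => exact ⟨Or.inl ⟨x, y, h, rfl⟩, by simpa using G.ne_of_adj h⟩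
      · exact ⟨Or.inr ⟨i, Or.inl rfl⟩, by simpa using (hne i).symm⟩
      · exact ⟨Or.inr ⟨i, Or.inr (Or.inl rfl)⟩, by simp⟩
      · exact ⟨Or.inr ⟨i, Or.inr (Or.inr rfl)⟩, by simp⟩

theorem layerData_snd_injective {m : ℕ} (hm : 0 < m) (H : SimpleGraph (Fin m))
    {u : Fin m → Fin m} (hu : Function.Injective u) :
    ∀ k, Function.Injective (layerData hm H u k).2
  | 0 => hu
  | _ + 1 => Sum.inr_injective

theorem exists_duplicates_layerData {m : ℕ} (hm : 3 ≤ m) (H : SimpleGraph (Fin m))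
    {u : Fin m → Fin m} (hu : Function.Injective u) {D : Multiset (Sym2 (Fin m))}
    (hD : ∀ e ∈ D, e ∈ H.edgeSet) (hdec : TriDecomp (edgeMS H + D)) (k : ℕ) :
    ∃ D' : Multiset (Sym2 (LayerType m k)), D'.card = D.card ∧
      (∀ e ∈ D', e ∈ (layerData (by omega) H u k).1.edgeSet) ∧
      TriDecomp (edgeMS (layerData (by omega) H u k).1 + D') := by
  induction k with
  | zero => exact ⟨D, rfl, hD, hdec⟩
  | succ k ih =>
    obtain ⟨D', hcard, hD', hdec'⟩ := ih
    have hE := edgeMS_layerExt hm (layerData (by omega) H u k).1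
      (layerData_snd_injective (by omega) H hu k)
    refine ⟨D'.map (Sym2.map Sum.inl), by simpa using hcard, fun e he => ?_, ?_⟩
    · refine mem_edgeMS.1 (hE ▸ Multiset.mem_add.2 (Or.inl ?_))
      obtain ⟨d, hd, rfl⟩ := Multiset.mem_map.1 he
      exact Multiset.mem_map_of_mem _ (mem_edgeMS.2 (hD' d hd))
    · have h := (hdec'.map Sum.inl_injective).add
        (triDecomp_layerEdges (by omega) (layerData (by omega) H u k).2)
      rw [Multiset.map_add, add_right_comm, ← hE] at h
      exact h

theorem card_layerType (m : ℕ) : ∀ k, Fintype.card (LayerType m k) = (k + 1) * m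
  | 0 => by
    change Fintype.card (Fin m) = _
    simp
  | k + 1 => by
    change Fintype.card (LayerType m k ⊕ Fin m) = _
    rw [Fintype.card_sum, card_layerType m k, Fintype.card_fin]
    ring

/-- First attachment vertex: vertices below `3 + r` form a fan centred at `0`; the later ones
come in blocks `z, w, w'` of three, where `z` is attached to the edge `{z - 1, 0}`, `w` to
`{z, z - 1}` and `w'` to `{z, 0}`. -/
def blockFst (r k : ℕ) : ℕ := if 3 + r ≤ k ∧ (k - r) % 3 = 2 then k - 2 else k - 1

/-- Second attachment vertex, see `blockFst`. -/
def blockSnd (r k : ℕ) : ℕ := if 3 + r ≤ k ∧ (k - r) % 3 = 1 then k - 2 else 0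

/-- The Hamiltonian cycle of the block construction: `z` and `w` are swapped in each block. -/
def blockCycle (r i : ℕ) : ℕ :=
  if 3 + r ≤ i then if (i - r) % 3 = 0 then i + 1 else if (i - r) % 3 = 1 then i - 1 else i else i

/-- The edges of the block construction on `n + 2` vertices, labelled by `c`. -/
def blockEdges {V : Type*} (c : ℕ → V) (r n : ℕ) : Multiset (Sym2 V) :=
  (Multiset.range (n + 1)).map (fun k => s(c (k + 1), c (blockFst r (k + 1)))) +
    (Multiset.range n).map (fun k => s(c (k + 2), c (blockSnd r (k + 2))))

/-- The edges of the block construction to be duplicated. -/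
def blockDuplicates {V : Type*} (c : ℕ → V) (r : ℕ) : Multiset (Sym2 V) :=
  (Multiset.range r).map (fun k => s(c (k + 2), c 0))

theorem triDecomp_fan {V : Type*} {c : ℕ → V} {r : ℕ} (n : ℕ) (hn : n ≤ r)
    (hc : Set.InjOn c (Set.Iio (n + 3))) :
    TriDecomp (blockEdges c r (n + 1) + blockDuplicates c n) := by
  have tri : ∀ i j k, i < n + 3 → j < i → k < j →
      TriDecomp ({s(c i, c j), s(c j, c k), s(c i, c k)} : Multiset (Sym2 V)) :=
    fun i j k hi hj hk => TriDecomp.triangle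
      (hc.ne (by simp; omega) (by simp; omega) (by omega))
      (hc.ne (by simp; omega) (by simp; omega) (by omega))
      (hc.ne (by simp; omega) (by simp; omega) (by omega))
  induction n with
  | zero =>
    convert tri 2 1 0 (by omega) (by omega) (by omega) using 1
    have h : ¬ 3 + r ≤ 2 := by omega
    have h' : ¬ 3 + r ≤ 1 := by omega
    simp [blockEdges, blockDuplicates, blockFst, blockSnd, Multiset.range_succ, h, h',
      ← Multiset.singleton_add]
    abel
  | succ n ih =>
    convert (ih (by omega) (hc.mono (Set.Iio_subset_Iio (by omega)))
      fun i j k hi => tri i j k (by omega)).add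
      (tri (n + 3) (n + 2) 0 (by omega) (by omega) (by omega)) using 1
    have hk : blockFst r (n + 3) = n + 2 ∧ blockSnd r (n + 3) = 0 := by
      unfold blockFst blockSnd; split_ifs <;> omega
    simp [blockEdges, blockDuplicates, Multiset.range_succ, ← Multiset.singleton_add, hk]
    abel

theorem triDecomp_block {V : Type*} {c : ℕ → V} {r : ℕ} (q : ℕ)
    (hc : Set.InjOn c (Set.Iio (r + 3 * q + 3))) :
    TriDecomp (blockEdges c r (r + 3 * q + 1) + blockDuplicates c r) := by
  induction q with
  | zero => exact triDecomp_fan r le_rfl hc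
  | succ q ih =>
    set n := r + 3 * q with hn
    have tri : ∀ i j k, i < n + 6 → j < i → k < j →
        TriDecomp ({s(c i, c j), s(c j, c k), s(c i, c k)} : Multiset (Sym2 V)) :=
      fun i j k hi hj hk => TriDecomp.triangle
        (hc.ne (by simp; omega) (by simp; omega) (by omega))
        (hc.ne (by simp; omega) (by simp; omega) (by omega))
        (hc.ne (by simp; omega) (by simp; omega) (by omega))
    convert ((ih (hc.mono (Set.Iio_subset_Iio (by omega)))).add
      (tri (n + 4) (n + 3) (n + 2) (by omega) (by omega) (by omega))).add
      (tri (n + 5) (n + 3) 0 (by omega) (by omega) (by omega)) using 1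
    have hz : blockFst r (n + 3) = n + 2 ∧ blockSnd r (n + 3) = 0 := by
      unfold blockFst blockSnd; split_ifs <;> omega
    have hw : blockFst r (n + 4) = n + 3 ∧ blockSnd r (n + 4) = n + 2 := by
      unfold blockFst blockSnd; split_ifs <;> omega
    have hw' : blockFst r (n + 5) = n + 3 ∧ blockSnd r (n + 5) = 0 := by
      unfold blockFst blockSnd; split_ifs <;> omega
    rw [show r + 3 * (q + 1) + 1 = n + 1 + 1 + 1 + 1 by omega]
    simp [blockEdges, Multiset.range_succ, ← Multiset.singleton_add, hz, hw, hw']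
    abel

theorem exists_isMOP_triDecomp_s8 (m : ℕ) (hm : 3 ≤ m) :
    ∃ (H : SimpleGraph (Fin m)) (u : Fin m → Fin m) (D : Multiset (Sym2 (Fin m))),
      IsMOP H ∧ Function.Bijective u ∧
      (∀ i : Fin m, H.Adj (u i) (u (nextFin (by omega) i))) ∧
      D.card = m % 3 ∧ (∀ e ∈ D, e ∈ H.edgeSet) ∧ TriDecomp (edgeMS H + D) := by
  obtain ⟨r, hr⟩ : ∃ r, r = m % 3 := ⟨_, rfl⟩
  obtain ⟨q, hq⟩ : ∃ q, m = r + 3 * q + 3 := ⟨m / 3 - 1, by omega⟩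
  have hm0 : 0 < m := by omega
  have hfst : ∀ k, 1 ≤ k → blockFst r k < k := by
    intro k hk; unfold blockFst; split_ifs <;> omega
  have hsnd : ∀ k, 1 ≤ k → blockSnd r k < k := by
    intro k hk; unfold blockSnd; split_ifs <;> omega
  let c : ℕ → Fin m := fun k => ⟨k % m, Nat.mod_lt _ hm0⟩
  have hcv : ∀ k, k < m → (c k : ℕ) = k := fun k hk => Nat.mod_eq_of_lt hk
  have hcc : ∀ k : Fin m, c k = k := fun k => Fin.ext (hcv k k.isLt)
  have hc : Set.InjOn c (Set.Iio m) := by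
    intro i hi j hj h
    rw [← hcv i hi, ← hcv j hj, h]
  have hs : ∀ i j k l, i < m → j < m → k < m → l < m →
      (s(c i, c j) = s(c k, c l) ↔ i = k ∧ j = l ∨ i = l ∧ j = k) := by
    intro i j k l hi hj hk hl
    simp only [Sym2.eq_iff, Fin.ext_iff, hcv _ hi, hcv _ hj, hcv _ hk, hcv _ hl]
  let a : Fin m → Fin m := fun k => c (blockFst r k)
  let b : Fin m → Fin m := fun k => c (blockSnd r k)
  have hmem : ∀ e, e ∈ mopEdges m hm a b ↔ e ∈ blockEdges c r (r + 3 * q + 1) := by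
    intro e
    have h0 : (⟨0, by omega⟩ : Fin m) = c 0 := Fin.ext (hcv 0 (by omega)).symm
    have h1 : (⟨1, by omega⟩ : Fin m) = c 1 := Fin.ext (hcv 1 (by omega)).symm
    have h2 : (⟨2, by omega⟩ : Fin m) = c 2 := Fin.ext (hcv 2 (by omega)).symm
    have f1 : blockFst r 1 = 0 := by unfold blockFst; split_ifs <;> omega
    have f2 : blockFst r 2 = 1 := by unfold blockFst; split_ifs <;> omega
    have g2 : blockSnd r 2 = 0 := by unfold blockSnd; split_ifs <;> omega
    simp only [mopEdges, Set.mem_ofPred_eq, blockEdges, Multiset.mem_add, Multiset.mem_map,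
      Multiset.mem_range, h0, h1, h2]
    constructor
    · rintro (rfl | rfl | rfl | ⟨k, hk, rfl | rfl⟩)
      · exact Or.inl ⟨0, by omega, by rw [zero_add, f1, Sym2.eq_swap]⟩
      · exact Or.inl ⟨1, by omega, by rw [one_add_one_eq_two, f2, Sym2.eq_swap]⟩
      · exact Or.inr ⟨0, by omega, by rw [zero_add, g2, Sym2.eq_swap]⟩
      · refine Or.inl ⟨k - 1, by omega, ?_⟩
        rw [Nat.sub_add_cancel (by omega), hcc]
      · refine Or.inr ⟨k - 2, by omega, ?_⟩
        rw [Nat.sub_add_cancel (by omega), hcc]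
    · rintro (⟨k, hk, rfl⟩ | ⟨k, hk, rfl⟩)
      · match k with
        | 0 => exact Or.inl (by rw [zero_add, f1, Sym2.eq_swap])
        | 1 => exact Or.inr (Or.inl (by rw [one_add_one_eq_two, f2, Sym2.eq_swap]))
        | k + 2 =>
          refine Or.inr (Or.inr (Or.inr ⟨c (k + 3), ?_, Or.inl ?_⟩))
          · rw [hcv _ (by omega)]; omega
          · simp only [a]; rw [hcv _ (by omega)]
      · match k with
        | 0 => exact Or.inr (Or.inr (Or.inl (by rw [zero_add, g2, Sym2.eq_swap])))
        | k + 1 =>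
          refine Or.inr (Or.inr (Or.inr ⟨c (k + 3), ?_, Or.inr ?_⟩))
          · rw [hcv _ (by omega)]; omega
          · simp only [b]; rw [hcv _ (by omega)]
  have hfstE : ∀ k, 1 ≤ k → k < m →
      s(c k, c (blockFst r k)) ∈ blockEdges c r (r + 3 * q + 1) := by
    intro k hk hkm
    refine Multiset.mem_add.2 (Or.inl (Multiset.mem_map.2 ⟨k - 1, ?_, ?_⟩))
    · simp; omega
    · rw [Nat.sub_add_cancel hk]
  have hsndE : ∀ k, 2 ≤ k → k < m →
      s(c k, c (blockSnd r k)) ∈ blockEdges c r (r + 3 * q + 1) := by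
    intro k hk hkm
    refine Multiset.mem_add.2 (Or.inr (Multiset.mem_map.2 ⟨k - 2, ?_, ?_⟩))
    · simp; omega
    · rw [Nat.sub_add_cancel hk]
  have hdiag : ∀ e ∈ blockEdges c r (r + 3 * q + 1), ¬ e.IsDiag := by
    intro e he
    rcases Multiset.mem_add.1 he with h | h
    · obtain ⟨k, hk, rfl⟩ := Multiset.mem_map.1 h
      rw [Multiset.mem_range] at hk
      have := hfst (k + 1) (by omega)
      exact hc.ne (by simp; omega) (by simp; omega) (by omega)
    · obtain ⟨k, hk, rfl⟩ := Multiset.mem_map.1 h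
      rw [Multiset.mem_range] at hk
      have := hsnd (k + 2) (by omega)
      exact hc.ne (by simp; omega) (by simp; omega) (by omega)
  have hnodup : (blockEdges c r (r + 3 * q + 1)).Nodup := by
    refine Multiset.nodup_add.2 ⟨Multiset.Nodup.map_on ?_ (Multiset.nodup_range _),
      Multiset.Nodup.map_on ?_ (Multiset.nodup_range _), Multiset.disjoint_left.2 ?_⟩
    · intro i hi j hj h
      rw [Multiset.mem_range] at hi hj
      have h1 := hfst (i + 1) (by omega)
      have h2 := hfst (j + 1) (by omega)
      rw [hs _ _ _ _ (by omega) (by omega) (by omega) (by omega)] at h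
      omega
    · intro i hi j hj h
      rw [Multiset.mem_range] at hi hj
      have h1 := hsnd (i + 2) (by omega)
      have h2 := hsnd (j + 2) (by omega)
      rw [hs _ _ _ _ (by omega) (by omega) (by omega) (by omega)] at h
      omega
    · intro e he he'
      obtain ⟨i, hi, rfl⟩ := Multiset.mem_map.1 he
      obtain ⟨j, hj, h⟩ := Multiset.mem_map.1 he'
      rw [Multiset.mem_range] at hi hj
      have h1 := hfst (i + 1) (by omega)
      have h2 := hsnd (j + 2) (by omega)
      rw [hs _ _ _ _ (by omega) (by omega) (by omega) (by omega)] at h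
      obtain rfl : i = j + 1 := by omega
      have h3 : blockSnd r (j + 2) = blockFst r (j + 1 + 1) := by omega
      unfold blockFst blockSnd at h3
      split_ifs at h3 <;> omega
  have hedge : ∀ e, e ∈ (SimpleGraph.fromEdgeSet (mopEdges m hm a b)).edgeSet ↔
      e ∈ blockEdges c r (r + 3 * q + 1) := by
    intro e
    rw [SimpleGraph.edgeSet_fromEdgeSet, Set.mem_sdiff, hmem]
    exact and_iff_left_of_imp (hdiag e)
  have hlt : ∀ i, i < m → blockCycle r i < m := by
    intro i hi; unfold blockCycle; split_ifs <;> omega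
  have huinj : Function.Injective fun i : Fin m => c (blockCycle r i) := by
    intro i j h
    have h := hc (hlt i i.isLt) (hlt j j.isLt) h
    ext
    unfold blockCycle at h
    split_ifs at h <;> omega
  refine ⟨SimpleGraph.fromEdgeSet (mopEdges m hm a b), fun i => c (blockCycle r i),
    blockDuplicates c r, ⟨hm, a, b, ?_, ?_, ?_, rfl⟩, Finite.injective_iff_bijective.1 huinj,
    ?_, by simp [blockDuplicates, hr], ?_, ?_⟩
  · intro k hk
    have h1 := hfst k (by omega)
    have h2 := hsnd k (by omega)
    refine ⟨(hcv _ (by omega)).trans_lt h1, (hcv _ (by omega)).trans_lt h2,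
      hc.ne (by simp; omega) (by simp; omega) ?_⟩
    unfold blockFst blockSnd
    split_ifs <;> omega
  · intro k hk
    rw [hmem]
    by_cases hw : 3 + r ≤ (k : ℕ) ∧ (k - r : ℕ) % 3 = 1
    · have h1 : blockFst r k = k - 1 := by unfold blockFst; split_ifs <;> omega
      have h2 : blockSnd r k = blockFst r (k - 1) := by
        simp only [blockFst, blockSnd]; split_ifs <;> omega
      simpa only [a, b, h1, h2] using hfstE (k - 1) (by omega) (by omega)
    · by_cases hw' : 3 + r ≤ (k : ℕ) ∧ (k - r : ℕ) % 3 = 2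
      · have h1 : blockFst r k = k - 2 := by unfold blockFst; split_ifs; omega
        have h2 : blockSnd r k = blockSnd r (k - 2) := by
          unfold blockSnd; split_ifs <;> omega
        simpa only [a, b, h1, h2] using hsndE (k - 2) (by omega) (by omega)
      · have h1 : blockFst r k = k - 1 := by unfold blockFst; split_ifs; omega
        have h2 : blockSnd r k = blockSnd r (k - 1) := by
          unfold blockSnd; split_ifs <;> omega
        simpa only [a, b, h1, h2] using hsndE (k - 1) (by omega) (by omega)
  · intro k l hk hl hkl h
    have h1 := hfst k (by omega)
    have h2 := hsnd k (by omega)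
    have h3 := hfst l (by omega)
    have h4 := hsnd l (by omega)
    rw [hs _ _ _ _ (by omega) (by omega) (by omega) (by omega)] at h
    apply hkl
    ext
    clear h1 h2 h3 h4
    unfold blockFst blockSnd at h
    split_ifs at h <;> omega
  · intro i
    rw [← SimpleGraph.mem_edgeSet, hedge]
    change s(c (blockCycle r i), c (blockCycle r (nextFin hm0 i))) ∈ _
    rw [nextFin_val]
    obtain ⟨i, hi⟩ := i
    dsimp only
    split_ifs with hlast
    · have h1 : blockCycle r i = m - 1 := by unfold blockCycle; split_ifs <;> omega
      have h2 : blockCycle r 0 = 0 := by unfold blockCycle; split_ifs <;> omega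
      have h3 : blockSnd r (m - 1) = 0 := by unfold blockSnd; split_ifs <;> omega
      rw [h1, h2]
      simpa only [h3] using hsndE (m - 1) (by omega) (by omega)
    rcases lt_or_ge i (2 + r) with hbase | hbase
    · have h1 : blockCycle r i = i := by unfold blockCycle; split_ifs <;> omega
      have h2 : blockCycle r (i + 1) = i + 1 := by unfold blockCycle; split_ifs <;> omega
      have h3 : blockFst r (i + 1) = i := by unfold blockFst; split_ifs <;> omega
      rw [h1, h2, Sym2.eq_swap]
      simpa only [h3] using hfstE (i + 1) (by omega) (by omega)
    obtain hi0 | hi1 | hi2 : (i - r) % 3 = 0 ∨ (i - r) % 3 = 1 ∨ (i - r) % 3 = 2 := by omega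
    · have h1 : blockCycle r i = i + 1 := by unfold blockCycle; split_ifs <;> omega
      have h2 : blockCycle r (i + 1) = i := by unfold blockCycle; split_ifs <;> omega
      have h3 : blockFst r (i + 1) = i := by unfold blockFst; split_ifs <;> omega
      rw [h1, h2]
      simpa only [h3] using hfstE (i + 1) (by omega) (by omega)
    · have h1 : blockCycle r i = i - 1 := by unfold blockCycle; split_ifs <;> omega
      have h2 : blockCycle r (i + 1) = i + 1 := by unfold blockCycle; split_ifs <;> omega
      have h3 : blockFst r (i + 1) = i - 1 := by unfold blockFst; split_ifs <;> omega
      rw [h1, h2, Sym2.eq_swap]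
      simpa only [h3] using hfstE (i + 1) (by omega) (by omega)
    · have h1 : blockCycle r i = i := by unfold blockCycle; split_ifs <;> omega
      have h2 : blockCycle r (i + 1) = i + 2 := by unfold blockCycle; split_ifs <;> omega
      have h3 : blockSnd r (i + 2) = i := by unfold blockSnd; split_ifs <;> omega
      rw [h1, h2, Sym2.eq_swap]
      simpa only [h3] using hsndE (i + 2) (by omega) (by omega)
  · intro e he
    rw [hedge]
    obtain ⟨k, hk, rfl⟩ := Multiset.mem_map.1 he
    rw [Multiset.mem_range] at hk
    have := hsndE (k + 2) (by omega) (by omega)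
    rwa [blockSnd, if_neg (by omega)] at this
  · rw [edgeMS_eq hnodup hedge]
    exact triDecomp_block q (hq ▸ hc)

/-- For all `m ≥ 3` and `k ≥ 1` there is a (`k`-outerplanar) graph `G` on `k·m` vertices
with `ε_Δ(G)` equal to the least residue of `m (mod 3)`, obtained from some maximal
outerplanar graph `H` of order `m` with Hamiltonian cycle `u_0, …, u_{m-1}` by
iteratively adding `k - 1` outer layers of `m` vertices each. -/
theorem exists_kOuterplanar_epsDelta (m k : ℕ) (hm : 3 ≤ m) (hk : 1 ≤ k) :
    ∃ (H : SimpleGraph (Fin m)) (u : Fin m → Fin m),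
      IsMOP H ∧ Function.Bijective u ∧
      (∀ i : Fin m, H.Adj (u i) (u (nextFin (by omega) i))) ∧
      Fintype.card (LayerType m (k - 1)) = k * m ∧
      epsDelta (layerData (by omega) H u (k - 1)).1 = m % 3 := by
  obtain ⟨H, u, D, hH, hu, hadj, hcard, hD, hdec⟩ := exists_isMOP_triDecomp_s8 m hm
  obtain ⟨D', hcard', hD', hdec'⟩ := exists_duplicates_layerData hm H hu.1 hD hdec (k - 1)
  refine ⟨H, u, hH, hu, hadj, ?_, ?_⟩
  · rw [card_layerType, Nat.sub_add_cancel hk]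
  · rw [epsDelta_eq_of_card_lt_three (by omega) hD' hdec', hcard', hcard]
end
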